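/- In the partially ordered set (S^lay, ⪯), any two elements admit a least upper bound; together with the existence of greatest lower bounds, (S^lay, ⪯) is a lattice. -/

import Mathlib

open scoped NNReal

/-- The set `S^lay = Stay ∪ Change ∪ {infeasible}`. -/
inductive Slay : Type where
  | st : ℝ≥0 → Slay
  | ch : ℝ≥0 → ℝ≥0 → Slay
  | infeasible : Slay

namespace Slay
/-- The partial order `⪯` on `S^lay`. -/
def le : Slay → Slay → Prop
  | _, infeasible => True
  | st a, st b => b ≤ a
  | st a, ch x y => x ≤ a ∧ y ≤ a
  | ch _ _, st _ => False
  | ch x y, ch u v => u ≤ x ∧ v ≤ y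
  | infeasible, _ => False

theorem le_refl (q : Slay) : le q q := by
  cases q <;> simp [le]

theorem le_trans {p q r : Slay} (hpq : le p q) (hqr : le q r) : le p r := by
  cases p <;> cases q <;> cases r <;> simp only [le] at * <;> grind

theorem le_antisymm {p q : Slay} (hpq : le p q) (hqp : le q p) : p = q := by
  cases p <;> cases q <;> simp only [le] at * <;> grind

/-- The least upper bound of two elements of `S^lay`. -/
noncomputable def join : Slay → Slay → Slay
  | st a, st b => st (min a b)
  | st a, ch x y => ch (min a x) (min a y)
  | ch x y, st a => ch (min x a) (min y a)
  | ch x y, ch u v => ch (min x u) (min y v)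
  | infeasible, _ => infeasible
  | _, infeasible => infeasible

/-- The greatest lower bound of two elements of `S^lay`. -/
noncomputable def meet : Slay → Slay → Slay
  | st a, st b => st (max a b)
  | st a, ch x y => st (max a (max x y))
  | ch x y, st a => st (max a (max x y))
  | ch x y, ch u v => ch (max x u) (max y v)
  | infeasible, q => q
  | q, infeasible => q

theorem le_join_left (p q : Slay) : le p (join p q) := by
  cases p <;> cases q <;> simp [le, join]

theorem le_join_right (p q : Slay) : le q (join p q) := by
  cases p <;> cases q <;> simp [le, join]

theorem join_le {p q r : Slay} (hp : le p r) (hq : le q r) : le (join p q) r := by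
  cases p <;> cases q <;> cases r <;> simp_all [le, join]

theorem meet_le_left (p q : Slay) : le (meet p q) p := by
  cases p <;> cases q <;> simp [le, meet]

theorem meet_le_right (p q : Slay) : le (meet p q) q := by
  cases p <;> cases q <;> simp [le, meet]

theorem le_meet {p q r : Slay} (hp : le r p) (hq : le r q) : le r (meet p q) := by
  cases p <;> cases q <;> cases r <;> simp_all [le, meet]

/-- The lattice structure on `S^lay` with order `le`. -/
@[reducible]
noncomputable def lattice : Lattice Slay where
  le := le
  le_refl := le_refl
  le_trans _ _ _ := le_trans
  le_antisymm _ _ := le_antisymm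
  sup := join
  le_sup_left := le_join_left
  le_sup_right := le_join_right
  sup_le _ _ _ := join_le
  inf := meet
  inf_le_left := meet_le_left
  inf_le_right := meet_le_right
  le_inf _ _ _ := le_meet

/-- In `(S^lay, ⪯)`, any two elements admit a least upper bound; together with the
existence of greatest lower bounds, `(S^lay, ⪯)` is a lattice. -/
theorem slay_lattice :
    (∀ q q' : Slay, ∃ j : Slay, le q j ∧ le q' j ∧ ∀ r : Slay, le q r → le q' r → le j r) ∧
    (∀ q q' : Slay, ∃ m : Slay, le m q ∧ le m q' ∧ ∀ r : Slay, le r q → le r q' → le r m) ∧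
    ∃ L : Lattice Slay, ∀ q q' : Slay, L.le q q' ↔ le q q' := by
  exact ⟨fun q q' => ⟨join q q', le_join_left q q', le_join_right q q', fun _ => join_le⟩,
    fun q q' => ⟨meet q q', meet_le_left q q', meet_le_right q q', fun _ => le_meet⟩,
    lattice, fun _ _ => Iff.rfl⟩

end Slay
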